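/- Let E be a finite-dimensional real inner product space and J_N, J_M : E →ₗ[ℝ] E linear maps (the Jacobians of the MLP pre-normalization and of the MLP operator). Let 𝒰_Z be a submodule of E, and define 𝒰_Q = 𝒰_Z.map J_N, 𝒰_M = 𝒰_Q.map J_M, and 𝒰_{X⁺} = 𝒰_Z.map (id + J_M ∘ J_N). For G ∈ E, let A = P_{𝒰_{X⁺}} G. Then the MLP-block leakage source decomposes exactly into four terms: P_{𝒰_Zᗮ}((id + J_M ∘ J_N)† A) = P_{𝒰_Zᗮ}(A) + J_N†(J_M†(P_{𝒰_Mᗮ} A)) + J_N†(P_{𝒰_Qᗮ}(J_M†(P_{𝒰_M} A))) + P_{𝒰_Zᗮ}(J_N†(P_{𝒰_Q}(J_M†(P_{𝒰_M} A)))). -/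

import Mathlib

open Submodule

/-- Orthogonal projection onto a submodule, viewed as a linear map into the ambient space. -/
noncomputable def projL {E : Type*} [NormedAddCommGroup E] [InnerProductSpace ℝ E]
    [FiniteDimensional ℝ E] (S : Submodule ℝ E) : E →ₗ[ℝ] E :=
  S.subtype ∘ₗ (orthogonalProjection S).toLinearMap

theorem projL_eq_star {E : Type*} [NormedAddCommGroup E] [InnerProductSpace ℝ E]
    [FiniteDimensional ℝ E] (S : Submodule ℝ E) (x : E) : projL S x = S.starProjection x := rfl

theorem projL_split {E : Type*} [NormedAddCommGroup E] [InnerProductSpace ℝ E]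
    [FiniteDimensional ℝ E] (S : Submodule ℝ E) (x : E) : projL S x + projL Sᗮ x = x := by
  rw [projL_eq_star, projL_eq_star]
  exact Submodule.starProjection_add_starProjection_orthogonal x

theorem projL_mem {E : Type*} [NormedAddCommGroup E] [InnerProductSpace ℝ E]
    [FiniteDimensional ℝ E] (S : Submodule ℝ E) (x : E) : projL S x ∈ S :=
  (S.orthogonalProjection x).2

theorem projL_of_mem {E : Type*} [NormedAddCommGroup E] [InnerProductSpace ℝ E]
    [FiniteDimensional ℝ E] (S : Submodule ℝ E) (x : E) (hx : x ∈ S) : projL S x = x := by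
  rw [projL_eq_star]
  exact Submodule.starProjection_eq_self_iff.mpr hx

theorem adjoint_mem_perp {E : Type*} [NormedAddCommGroup E] [InnerProductSpace ℝ E]
    [FiniteDimensional ℝ E] (J : E →ₗ[ℝ] E) (S : Submodule ℝ E) (x : E)
    (hx : x ∈ (S.map J)ᗮ) : LinearMap.adjoint J x ∈ Sᗮ := by
  rw [Submodule.mem_orthogonal] at hx ⊢
  intro u hu
  rw [LinearMap.adjoint_inner_right]
  exact hx _ (Submodule.mem_map_of_mem hu)

theorem mlp_block_leakage_decomposition
    {E : Type*} [NormedAddCommGroup E] [InnerProductSpace ℝ E] [FiniteDimensional ℝ E]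
    (J_N J_M : E →ₗ[ℝ] E) (𝒰Z : Submodule ℝ E) (G : E)
    (𝒰Q : Submodule ℝ E) (hUQ : 𝒰Q = 𝒰Z.map J_N)
    (𝒰M : Submodule ℝ E) (hUM : 𝒰M = 𝒰Q.map J_M)
    (𝒰X' : Submodule ℝ E) (hUX' : 𝒰X' = 𝒰Z.map (LinearMap.id + J_M ∘ₗ J_N))
    (A : E) (hA : A = projL 𝒰X' G) :
    projL 𝒰Zᗮ (LinearMap.adjoint (LinearMap.id + J_M ∘ₗ J_N) A) =
      projL 𝒰Zᗮ A
      + LinearMap.adjoint J_N (LinearMap.adjoint J_M (projL 𝒰Mᗮ A))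
      + LinearMap.adjoint J_N (projL 𝒰Qᗮ (LinearMap.adjoint J_M (projL 𝒰M A)))
      + projL 𝒰Zᗮ
          (LinearMap.adjoint J_N (projL 𝒰Q (LinearMap.adjoint J_M (projL 𝒰M A)))) := by
  subst hUQ hUM
  have h1 := projL_of_mem 𝒰Zᗮ _ (adjoint_mem_perp J_N 𝒰Z _
    (adjoint_mem_perp J_M _ _ (projL_mem ((𝒰Z.map J_N).map J_M)ᗮ A)))
  have h2 := projL_of_mem 𝒰Zᗮ _ (adjoint_mem_perp J_N 𝒰Z _
    (projL_mem (𝒰Z.map J_N)ᗮ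
      (LinearMap.adjoint J_M (projL ((𝒰Z.map J_N).map J_M) A))))
  have e1 := projL_split ((𝒰Z.map J_N).map J_M) A
  have e2 := projL_split (𝒰Z.map J_N)
    (LinearMap.adjoint J_M (projL ((𝒰Z.map J_N).map J_M) A))
  have e3 : LinearMap.adjoint (LinearMap.id + J_M ∘ₗ J_N) A =
      A + LinearMap.adjoint J_N (LinearMap.adjoint J_M A) := by
    rw [map_add, LinearMap.adjoint_comp, LinearMap.adjoint_id]
    rfl
  rw [e3, map_add, ← h1, ← h2, add_assoc, add_assoc, ← map_add, ← map_add, ← map_add, ← map_add]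
  congr 1
  rw [← map_add (LinearMap.adjoint J_N), add_comm (projL _ᗮ _) (projL _ _), e2,
    ← map_add (LinearMap.adjoint J_N), ← map_add, add_comm (projL _ᗮ _) (projL _ _), e1]
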